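/- arXiv:1804.10353 — 6 statements merged into one kernel-verified Lean document; each statement's English description precedes it below -/
import Mathlib

section
/- In any matching instance I, if an agent r ∈ P ∪ Q is matched in some stable matching of I, then r is matched in every stable matching of I; equivalently, all stable matchings of I match exactly the same set of firms and workers. -/
namespace SeqMatching

/-- A matching instance `I = (P, Q, E, ≻)`: firms `P`, workers `Q`, a finite set `E`
of acceptable pairs, and strict preferences encoded by rank functions
(lower rank = more preferred), injective on acceptable partners.
For a firm `p`, `q ≻_p q'` means `rankP p q < rankP p q'`; symmetrically for workers. -/
structure MI (P Q : Type) where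
  E : Finset (P × Q)
  rankP : P → Q → ℕ
  rankQ : Q → P → ℕ
  injP : ∀ p q q', (p, q) ∈ E → (p, q') ∈ E → rankP p q = rankP p q' → q = q'
  injQ : ∀ q p p', (p, q) ∈ E → (p', q) ∈ E → rankQ q p = rankQ q p' → p = p'

namespace MI

variable {P Q : Type}

/-- `μ` is a matching in `I`: a subset of `E` in which every firm and every worker
occurs in at most one pair. -/
def IsMatching (I : MI P Q) (μ : Finset (P × Q)) : Prop :=
  μ ⊆ I.E ∧ ∀ e ∈ μ, ∀ f ∈ μ, (e.1 = f.1 ∨ e.2 = f.2) → e = f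

/-- `μ(q) ⪰_q p`: worker `q` is matched in `μ` to `p` or to a firm she strictly prefers to `p`. -/
def WAtLeast (I : MI P Q) (μ : Finset (P × Q)) (q : Q) (p : P) : Prop :=
  ∃ p', (p', q) ∈ μ ∧ (p' = p ∨ I.rankQ q p' < I.rankQ q p)

/-- `p ≻_q μ(q)`: worker `q` is unmatched in `μ` or matched to a firm strictly less preferred than `p`. -/
def WBelow (I : MI P Q) (μ : Finset (P × Q)) (q : Q) (p : P) : Prop :=
  ∀ p', (p', q) ∈ μ → I.rankQ q p < I.rankQ q p'

/-- `q ≻_p μ(p)`: firm `p` is unmatched in `μ` or matched to a worker strictly less preferred than `q`. -/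
def FBelow (I : MI P Q) (μ : Finset (P × Q)) (p : P) (q : Q) : Prop :=
  ∀ q', (p, q') ∈ μ → I.rankP p q < I.rankP p q'

/-- the acceptable pair `e = (p, q)` blocks `μ`. -/
def Blocks (I : MI P Q) (μ : Finset (P × Q)) (e : P × Q) : Prop :=
  e ∈ I.E ∧ I.FBelow μ e.1 e.2 ∧ I.WBelow μ e.2 e.1

/-- `μ` is a stable matching in `I`. -/
def IsStable (I : MI P Q) (μ : Finset (P × Q)) : Prop :=
  I.IsMatching μ ∧ ∀ e, ¬ I.Blocks μ e

/-- `μ(q) ⪰_q μ'(q)`: worker `q` weakly prefers `μ` to `μ'`. -/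
def WGe (I : MI P Q) (μ μ' : Finset (P × Q)) (q : Q) : Prop :=
  ∀ p', (p', q) ∈ μ' → I.WAtLeast μ q p'

/-- `μ` is the Q-optimal (worker-optimal) stable matching of `I`. -/
def IsQOpt (I : MI P Q) (μ : Finset (P × Q)) : Prop :=
  I.IsStable μ ∧ ∀ μ', I.IsStable μ' → ∀ q, I.WGe μ μ' q

open scoped Classical in
/-- the Q-optimal stable matching `qopt(I)` (it exists and is unique by Gale–Shapley). -/
noncomputable def qopt (I : MI P Q) : Finset (P × Q) :=
  if h : ∃ μ, I.IsQOpt μ then h.choose else ∅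

/-- `q` is the most preferred worker on `p`'s list. -/
def TopForFirm (I : MI P Q) (p : P) (q : Q) : Prop :=
  (p, q) ∈ I.E ∧ ∀ q', (p, q') ∈ I.E → I.rankP p q ≤ I.rankP p q'

/-- `p` is the most preferred firm on `q`'s list. -/
def TopForWorker (I : MI P Q) (q : Q) (p : P) : Prop :=
  (p, q) ∈ I.E ∧ ∀ p', (p', q) ∈ I.E → I.rankQ q p ≤ I.rankQ q p'

variable [DecidableEq P] [DecidableEq Q]

/-- a (2,∞)-instance: every firm has at most two acceptable workers. -/
def FirmsDegTwo (I : MI P Q) : Prop :=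
  ∀ p : P, (I.E.filter (fun f => f.1 = p)).card ≤ 2

/-- an (∞,2)-instance: every worker has at most two acceptable firms. -/
def WorkersDegTwo (I : MI P Q) : Prop :=
  ∀ q : Q, (I.E.filter (fun f => f.2 = q)).card ≤ 2

/-- the deletion `I ∖ e`. -/
def del (I : MI P Q) (e : P × Q) : MI P Q where
  E := I.E.erase e
  rankP := I.rankP
  rankQ := I.rankQ
  injP := fun p q q' h h' hr =>
    I.injP p q q' (Finset.mem_of_mem_erase h) (Finset.mem_of_mem_erase h') hr
  injQ := fun q p p' h h' hr =>
    I.injQ q p p' (Finset.mem_of_mem_erase h) (Finset.mem_of_mem_erase h') hr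

/-- the contraction `I / e`: all pairs containing the firm or the worker of `e` are removed. -/
def contr (I : MI P Q) (e : P × Q) : MI P Q where
  E := I.E.filter (fun f => f.1 ≠ e.1 ∧ f.2 ≠ e.2)
  rankP := I.rankP
  rankQ := I.rankQ
  injP := fun p q q' h h' hr =>
    I.injP p q q' (Finset.filter_subset _ _ h) (Finset.filter_subset _ _ h') hr
  injQ := fun q p p' h h' hr =>
    I.injQ q p p' (Finset.filter_subset _ _ h) (Finset.filter_subset _ _ h') hr

/-- `σ` is an offering order on `I`: an enumeration of `E` without repetition, consistent
with the firms' preferences (if `e ≻_p f` for two offers of the same firm, `e` comes first). -/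
def IsOfferOrder (I : MI P Q) (σ : List (P × Q)) : Prop :=
  σ.Nodup ∧ (∀ e, e ∈ σ ↔ e ∈ I.E) ∧
    ∀ e f, e ∈ σ → f ∈ σ → e.1 = f.1 → I.rankP e.1 e.2 < I.rankP f.1 f.2 →
      σ.idxOf e < σ.idxOf f

/-- restriction `σ / e` of the order `σ` to the pairs of `I / e`. -/
def contrO (σ : List (P × Q)) (e : P × Q) : List (P × Q) :=
  σ.filter (fun f => decide (f.1 ≠ e.1 ∧ f.2 ≠ e.2))

theorem qopt_subset (I : MI P Q) : I.qopt ⊆ I.E := by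
  unfold qopt
  split
  · next h => exact h.choose_spec.1.1.1
  · exact Finset.empty_subset _

/-- the sequentially fixing deferred acceptance algorithm: repeatedly fix the pair of
`qopt` of the current instance that comes first in the offering order. -/
noncomputable def sfda (I : MI P Q) (σ : List (P × Q)) : Finset (P × Q) :=
  match h : σ.find? (fun f => decide (f ∈ I.qopt)) with
  | none => ∅
  | some e => insert e ((I.contr e).sfda (contrO σ e))
termination_by σ.length
decreasing_by
  have he : e ∈ σ := List.mem_of_find?_eq_some h
  have hfail : ¬ (fun f => decide (f.1 ≠ e.1 ∧ f.2 ≠ e.2)) e = true := by simp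
  exact List.length_filter_lt_length_iff_exists.mpr ⟨e, he, hfail⟩

open scoped Classical in
/-- the SPE matching `spe(I, σ)` of the sequential matching game `(I, σ)`. -/
noncomputable def spe (I : MI P Q) (σ : List (P × Q)) : Finset (P × Q) :=
  match σ with
  | [] => ∅
  | e :: rest =>
    if I.WBelow ((I.del e).spe rest) e.2 e.1
    then insert e ((I.contr e).spe (contrO rest e))
    else (I.del e).spe rest
termination_by σ.length
decreasing_by
  all_goals simp only [contrO, List.length_cons]
  all_goals first
    | omega
    | exact Nat.lt_succ_of_le (List.length_filter_le _ _)


theorem cycle_aux {P Q : Type} (I : MI P Q) (μ ν : Finset (P × Q))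
    (hμ : I.IsStable μ) (hν : I.IsStable ν) (p : P) (q : Q) (hpq : (p, q) ∈ μ)
    (hb : I.FBelow ν p q) : ∃ q0 p0, (p, q0) ∈ ν ∧ (p0, q0) ∈ μ := by
  classical
  set A := μ.filter (fun e => I.FBelow ν e.1 e.2) with hA
  have key : ∀ e : P × Q, ∃ g : P × Q, e ∈ A → g ∈ A ∧ (g.1, e.2) ∈ ν := by
    rintro ⟨a, b⟩
    by_cases he : (a, b) ∈ A
    swap
    · exact ⟨(a, b), fun h => absurd h he⟩
    obtain ⟨hm, hf⟩ := Finset.mem_filter.1 he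
    have hE := hμ.1.1 hm
    have h1 : ¬ I.WBelow ν b a := fun hw => hν.2 (a, b) ⟨hE, hf, hw⟩
    unfold WBelow at h1
    push Not at h1
    obtain ⟨a', ha', hr⟩ := h1
    have hne : a' ≠ a := by
      rintro rfl
      exact lt_irrefl _ (hf b ha')
    have hE' := hν.1.1 ha'
    have hlt : I.rankQ b a' < I.rankQ b a :=
      lt_of_le_of_ne hr (fun h => hne (I.injQ b a' a hE' hE h))
    have hw : I.WBelow μ b a' := by
      intro x hx
      have := hμ.1.2 _ hx _ hm (Or.inr rfl)
      obtain rfl : x = a := congrArg Prod.fst this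
      exact hlt
    have h2 : ¬ I.FBelow μ a' b := fun hf' => hμ.2 (a', b) ⟨hE', hf', hw⟩
    unfold FBelow at h2
    push Not at h2
    obtain ⟨b', hb', hr'⟩ := h2
    have hne' : b' ≠ b := by
      rintro rfl
      exact hne (congrArg Prod.fst (hμ.1.2 _ hb' _ hm (Or.inr rfl)))
    have hlt' : I.rankP a' b' < I.rankP a' b :=
      lt_of_le_of_ne hr' (fun h => hne' (I.injP a' b' b (hμ.1.1 hb') hE' h))
    refine ⟨(a', b'), fun _ => ⟨Finset.mem_filter.2 ⟨hb', ?_⟩, ha'⟩⟩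
    intro y hy
    have := hν.1.2 _ hy _ ha' (Or.inl rfl)
    obtain rfl : y = b := congrArg Prod.snd this
    exact hlt'
  choose f hf using key
  have hinj : Set.InjOn f A := by
    intro e he e' he' h
    have h1 := (hf e he).2
    have h2 := (hf e' he').2
    rw [h] at h1
    have h3 : e.2 = e'.2 := (Prod.mk.inj (hν.1.2 _ h1 _ h2 (Or.inl rfl))).2
    exact hμ.1.2 _ (Finset.mem_filter.1 he).1 _ (Finset.mem_filter.1 he').1 (Or.inr h3)
  have hsurj := Finset.surjOn_of_injOn_of_card_le f (s := A) (t := A)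
    (fun e he => (hf e he).1) hinj le_rfl
  obtain ⟨e, he, hfe⟩ := hsurj (show (p, q) ∈ (A : Set (P × Q)) from
    Finset.mem_coe.2 (Finset.mem_filter.2 ⟨hpq, hb⟩))
  have h := (hf e he).2
  rw [hfe] at h
  exact ⟨e.2, e.1, h, (Finset.mem_filter.1 he).1⟩

theorem firm_aux {P Q : Type} (I : MI P Q) (μ ν : Finset (P × Q))
    (hμ : I.IsStable μ) (hν : I.IsStable ν) (p : P) (h : ∃ q, (p, q) ∈ μ) :
    ∃ q, (p, q) ∈ ν := by
  by_contra hn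
  obtain ⟨q, hq⟩ := h
  obtain ⟨q0, _, h0, _⟩ := cycle_aux I μ ν hμ hν p q hq (fun q' h' => absurd ⟨q', h'⟩ hn)
  exact hn ⟨q0, h0⟩

theorem worker_aux {P Q : Type} (I : MI P Q) (μ ν : Finset (P × Q))
    (hμ : I.IsStable μ) (hν : I.IsStable ν) (q : Q) (h : ∃ p, (p, q) ∈ μ) :
    ∃ p, (p, q) ∈ ν := by
  by_contra hn
  obtain ⟨p, hp⟩ := h
  have hE := hμ.1.1 hp
  have h1 : ¬ I.FBelow ν p q := fun hf =>
    hν.2 (p, q) ⟨hE, hf, fun p' h' => absurd ⟨p', h'⟩ hn⟩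
  unfold FBelow at h1
  push Not at h1
  obtain ⟨q2, h2, hr⟩ := h1
  have hne : q2 ≠ q := by
    rintro rfl
    exact hn ⟨p, h2⟩
  have hlt : I.rankP p q2 < I.rankP p q :=
    lt_of_le_of_ne hr (fun h => hne (I.injP p q2 q (hν.1.1 h2) hE h))
  obtain ⟨q0, p0, h0, h0'⟩ := cycle_aux I ν μ hν hμ p q2 h2 (by
    intro y hy
    obtain rfl : y = q := congrArg Prod.snd (hμ.1.2 _ hy _ hp (Or.inl rfl))
    exact hlt)
  obtain rfl : q0 = q := congrArg Prod.snd (hμ.1.2 _ h0 _ hp (Or.inl rfl))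
  exact hn ⟨p0, h0'⟩

/-- all stable matchings of a matching instance match exactly the same
set of firms and workers (invariance of unmatched agents / rural hospital theorem). -/
theorem stmt_0 (P Q : Type) (I : MI P Q) (μ₁ μ₂ : Finset (P × Q))
    (h₁ : I.IsStable μ₁) (h₂ : I.IsStable μ₂) :
    (∀ p : P, (∃ q, (p, q) ∈ μ₁) ↔ ∃ q, (p, q) ∈ μ₂) ∧
    (∀ q : Q, (∃ p, (p, q) ∈ μ₁) ↔ ∃ p, (p, q) ∈ μ₂) := by
  exact ⟨fun p => ⟨firm_aux I μ₁ μ₂ h₁ h₂ p, firm_aux I μ₂ μ₁ h₂ h₁ p⟩,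
    fun q => ⟨worker_aux I μ₁ μ₂ h₁ h₂ q, worker_aux I μ₂ μ₁ h₂ h₁ q⟩⟩

end MI

end SeqMatching
end

section
/- Let I be a matching instance and e=(p,q) ∈ E a pair with qopt(I)(q)=p. Then p ≻_q qopt(I∖e)(q), i.e., in the Q-optimal stable matching of the instance obtained by deleting e, the worker q is unmatched or matched to a firm she prefers strictly less than p. -/
namespace SeqMatching

namespace MI

variable {P Q : Type}

variable [DecidableEq P] [DecidableEq Q]

/-- if `qopt(I)(q) = p` for `e = (p, q) ∈ E`, then `p ≻_q qopt(I ∖ e)(q)`. -/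
theorem stmt_2 (P Q : Type) [DecidableEq P] [DecidableEq Q] (I : MI P Q) (p : P) (q : Q)
    (he : (p, q) ∈ I.E) (μ₀ ν : Finset (P × Q))
    (h₀ : I.IsQOpt μ₀) (hpq : (p, q) ∈ μ₀)
    (hν : (I.del (p, q)).IsQOpt ν) :
    I.WBelow ν q p := by
  intro p' hp'
  by_contra hlt
  have hE := hν.1.1.1 hp'
  have hE' : (p', q) ∈ I.E := Finset.mem_of_mem_erase hE
  have hne : p' ≠ p := by
    rintro rfl
    exact Finset.ne_of_mem_erase hE rfl
  have hst : I.IsStable ν := by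
    refine ⟨⟨fun x hx => Finset.mem_of_mem_erase (hν.1.1.1 hx), hν.1.1.2⟩, ?_⟩
    rintro e ⟨h1, h2, h3⟩
    by_cases hee : e = (p, q)
    · subst hee
      exact hlt (h3 p' hp')
    · exact hν.1.2 e ⟨Finset.mem_erase.mpr ⟨hee, h1⟩, h2, h3⟩
  obtain ⟨r, hr, hr'⟩ := h₀.2 ν hst q p' hp'
  have hrp : (r, q) = (p, q) := h₀.1.1.2 _ hr _ hpq (Or.inr rfl)
  obtain rfl : r = p := congrArg Prod.fst hrp
  rcases hr' with h | h
  · exact hne h.symm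
  · exact hlt h

end MI

end SeqMatching
end

section
/- Let I be a matching instance and e=(p,q) ∈ E a pair with qopt(I)(q)=p. Then qopt(I/e)+e ⪰_Q qopt(I), i.e., adding the pair e to the Q-optimal stable matching of the contracted instance gives a matching in I that every worker weakly prefers to qopt(I). -/
namespace SeqMatching

namespace MI

variable {P Q : Type}

variable [DecidableEq P] [DecidableEq Q]

/-- if `qopt(I)(q) = p` for `e = (p, q) ∈ E`, then `qopt(I/e) + e ⪰_Q qopt(I)`. -/
theorem stmt_3 (P Q : Type) [DecidableEq P] [DecidableEq Q] (I : MI P Q) (p : P) (q : Q)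
    (he : (p, q) ∈ I.E) (μ₀ ν : Finset (P × Q))
    (h₀ : I.IsQOpt μ₀) (hpq : (p, q) ∈ μ₀)
    (hν : (I.contr (p, q)).IsQOpt ν) :
    ∀ q' : Q, I.WGe (insert (p, q) ν) μ₀ q' := by
  intro q' p' hp'
  have hst : (I.contr (p, q)).IsStable (μ₀.erase (p, q)) := by
    obtain ⟨⟨hsub, hm⟩, hb⟩ := h₀.1
    refine ⟨⟨?_, ?_⟩, ?_⟩
    · intro f hf
      obtain ⟨hne, hf⟩ := Finset.mem_erase.mp hf
      refine Finset.mem_filter.mpr ⟨hsub hf, ?_, ?_⟩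
      · intro h
        exact hne (hm f hf (p, q) hpq (Or.inl h))
      · intro h
        exact hne (hm f hf (p, q) hpq (Or.inr h))
    · intro f hf g hg h
      exact hm f (Finset.mem_of_mem_erase hf) g (Finset.mem_of_mem_erase hg) h
    · rintro ⟨a, b⟩ ⟨hE, hF, hW⟩
      obtain ⟨hE, ha, hb'⟩ := Finset.mem_filter.mp hE
      refine hb (a, b) ⟨hE, ?_, ?_⟩
      · intro b' h
        refine hF b' (Finset.mem_erase.mpr ⟨?_, h⟩)
        intro heq
        exact ha (Prod.mk.inj heq).1
      · intro a' h
        refine hW a' (Finset.mem_erase.mpr ⟨?_, h⟩)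
        intro heq
        exact hb' (Prod.mk.inj heq).2
  by_cases h : (p', q') = (p, q)
  · exact ⟨p', Finset.mem_insert.mpr (Or.inl h), Or.inl rfl⟩
  · obtain ⟨r, hr, hr'⟩ := hν.2 _ hst q' p' (Finset.mem_erase.mpr ⟨h, hp'⟩)
    exact ⟨r, Finset.mem_insert_of_mem hr, hr'⟩

end MI

end SeqMatching
end

section
/- Let I be a matching instance and e=(p,q) ∈ E a pair with qopt(I)(q) ≻_q p, i.e., in the Q-optimal stable matching q is matched to a firm she strictly prefers to p. Then qopt(I)=qopt(I∖e). -/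
namespace SeqMatching

namespace MI

variable {P Q : Type}

variable [DecidableEq P] [DecidableEq Q]

/-- if `qopt(I)(q) ≻_q p` for `e = (p, q) ∈ E`, then `qopt(I) = qopt(I ∖ e)`. -/
theorem stmt_4 (P Q : Type) [DecidableEq P] [DecidableEq Q] (I : MI P Q) (p : P) (q : Q)
    (he : (p, q) ∈ I.E) (μ₀ ν : Finset (P × Q))
    (h₀ : I.IsQOpt μ₀)
    (hstrict : ∃ p', (p', q) ∈ μ₀ ∧ I.rankQ q p' < I.rankQ q p)
    (hν : (I.del (p, q)).IsQOpt ν) :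
    μ₀ = ν := by
  obtain ⟨p', hp', hlt⟩ := hstrict
  have hnot : (p, q) ∉ μ₀ := by
    intro h
    have h1 := h₀.1.1.2 _ hp' _ h (Or.inr rfl)
    have h2 : p' = p := congrArg Prod.fst h1
    subst h2
    exact lt_irrefl _ hlt
  have hst : (I.del (p, q)).IsStable μ₀ := by
    refine ⟨⟨?_, h₀.1.1.2⟩, ?_⟩
    · intro f hf
      exact Finset.mem_erase.mpr ⟨fun h => hnot (h ▸ hf), h₀.1.1.1 hf⟩
    · rintro f ⟨h1, h2, h3⟩
      exact h₀.1.2 f ⟨Finset.mem_of_mem_erase h1, h2, h3⟩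
  have hge : ∀ r, I.WGe ν μ₀ r := hν.2 μ₀ hst
  have hst' : I.IsStable ν := by
    refine ⟨⟨fun f hf => Finset.mem_of_mem_erase (hν.1.1.1 hf), hν.1.1.2⟩, ?_⟩
    rintro f ⟨h1, h2, h3⟩
    by_cases hf : f = (p, q)
    · subst hf
      obtain ⟨a, ha, hab⟩ := hge q p' hp'
      have h4 : I.rankQ q p < I.rankQ q a := h3 a ha
      rcases hab with rfl | hab
      · omega
      · omega
    · exact hν.1.2 f ⟨Finset.mem_erase.mpr ⟨hf, h1⟩, h2, h3⟩
  have hge' : ∀ r, I.WGe μ₀ ν r := h₀.2 ν hst'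
  have key : ∀ α β : Finset (P × Q), I.IsStable α → (∀ r, I.WGe α β r) →
      (∀ r, I.WGe β α r) → α ⊆ β := by
    rintro α β hα hab hba ⟨a, r⟩ ha
    obtain ⟨b, hb, hb'⟩ := hba r a ha
    obtain ⟨c, hc, hc'⟩ := hab r b hb
    have hca : c = a := congrArg Prod.fst (hα.1.2 _ hc _ ha (Or.inr rfl))
    subst hca
    rcases hb' with rfl | hb'
    · exact hb
    · rcases hc' with rfl | hc'
      · exact hb
      · omega
  exact Finset.Subset.antisymm (key _ _ h₀.1 hge' hge) (key _ _ hst' hge hge')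

end MI

end SeqMatching
end

section
/- For any matching instance I and any offering order σ on I, sfda(I,σ) ⪰_Q qopt(I), i.e., every worker weakly prefers her partner under the output of the sequentially fixing deferred acceptance algorithm to her partner under the Q-optimal stable matching. -/
namespace SeqMatching

namespace MI

variable {P Q : Type}

variable [DecidableEq P] [DecidableEq Q]

theorem aux_wge_trans (I : MI P Q) {a b c : Finset (P × Q)} {q : Q}
    (h1 : I.WGe a b q) (h2 : I.WGe b c q) : I.WGe a c q := by
  intro p hp
  obtain ⟨p', hp', h⟩ := h2 p hp
  obtain ⟨p'', hp'', h'⟩ := h1 p' hp'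
  refine ⟨p'', hp'', ?_⟩
  rcases h with rfl | h
  · exact h'
  · rcases h' with rfl | h'
    · exact Or.inr h
    · have hlt := h'.trans h
      exact Or.inr hlt

/-- If two workers share the top firm `p`, deleting the worse pair keeps the stable set. -/
theorem aux_del_stable (I : MI P Q) {p : P} {q q' : Q} (hq : I.TopForWorker q p)
    (hlt : I.rankP p q < I.rankP p q') (μ : Finset (P × Q)) :
    (I.del (p, q')).IsStable μ ↔ I.IsStable μ := by
  have hne : q ≠ q' := by rintro rfl; exact lt_irrefl _ hlt
  constructor
  · rintro ⟨⟨hs, hm⟩, hb⟩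
    have hsE : μ ⊆ I.E := fun f hf => Finset.mem_of_mem_erase (hs hf)
    refine ⟨⟨hsE, hm⟩, ?_⟩
    rintro f ⟨hf, h1, h2⟩
    by_cases hfe : f = (p, q')
    · subst hfe
      apply hb (p, q)
      refine ⟨Finset.mem_erase.2 ⟨by simp [hne], hq.1⟩, ?_, ?_⟩
      · intro x hx
        exact hlt.trans (h1 x hx)
      · intro x hx
        refine lt_of_le_of_ne (hq.2 x (hsE hx)) ?_
        intro hEq
        have := I.injQ q p x hq.1 (hsE hx) hEq
        subst this
        exact lt_asymm hlt (h1 q hx)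
    · exact hb f ⟨Finset.mem_erase.2 ⟨hfe, hf⟩, h1, h2⟩
  · rintro ⟨⟨hs, hm⟩, hb⟩
    have hnot : (p, q') ∉ μ := by
      intro hmem
      apply hb (p, q)
      refine ⟨hq.1, ?_, ?_⟩
      · intro x hx
        have := hm _ hx _ hmem (Or.inl rfl)
        simp only [Prod.mk.injEq, true_and] at this
        subst this
        exact hlt
      · intro x hx
        refine lt_of_le_of_ne (hq.2 x (hs hx)) ?_
        intro hEq
        have := I.injQ q p x hq.1 (hs hx) hEq
        subst this
        have := hm _ hx _ hmem (Or.inl rfl)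
        simp only [Prod.mk.injEq, true_and] at this
        exact hne this
    refine ⟨⟨fun f hf => Finset.mem_erase.2 ⟨?_, hs hf⟩, hm⟩, ?_⟩
    · rintro rfl; exact hnot hf
    · rintro f ⟨hf, h1, h2⟩
      exact hb f ⟨Finset.mem_of_mem_erase hf, h1, h2⟩

open scoped Classical in
/-- Gale–Shapley: a Q-optimal stable matching exists. -/
theorem aux_exists_qopt : ∀ (n : ℕ) (I : MI P Q), I.E.card = n → ∃ μ, I.IsQOpt μ := by
  intro n
  induction n with
  | zero =>
    intro I hI
    have hE : I.E = ∅ := Finset.card_eq_zero.1 hI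
    refine ⟨∅, ⟨⟨by simp, by simp⟩, ?_⟩, ?_⟩
    · rintro e ⟨he, -⟩; simp [hE] at he
    · intro μ' h q p hp
      have := h.1.1 hp
      simp [hE] at this
  | succ n ih =>
    intro I hI
    by_cases hc : ∃ p q q', I.TopForWorker q p ∧ I.TopForWorker q' p ∧
        I.rankP p q < I.rankP p q'
    · obtain ⟨p, q, q', h1, h2, hlt⟩ := hc
      obtain ⟨μ, hμ, hopt⟩ := ih (I.del (p, q')) (by
        change (I.E.erase (p, q')).card = n
        rw [Finset.card_erase_of_mem h2.1, hI]; rfl)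
      refine ⟨μ, (aux_del_stable I h1 hlt μ).1 hμ, ?_⟩
      intro μ' hμ'
      exact hopt μ' ((aux_del_stable I h1 hlt μ').2 hμ')
    · push Not at hc
      have htop : ∀ p q, (p, q) ∈ I.E → ∃ p', I.TopForWorker q p' := by
        intro p q hpq
        obtain ⟨f, hf, hmin⟩ := Finset.exists_min_image (I.E.filter (fun f => f.2 = q))
          (fun f => I.rankQ q f.1) ⟨(p, q), by simp [hpq]⟩
        obtain ⟨a, b⟩ := f
        simp only [Finset.mem_filter] at hf
        obtain ⟨hf, rfl⟩ := hf
        exact ⟨a, hf, fun p' hp' => hmin (p', b) (by simp [hp'])⟩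
      have hge : ∀ p q, (p, q) ∈ I.E → ∃ p', I.TopForWorker q p' ∧
          (p' = p ∨ I.rankQ q p' < I.rankQ q p) := by
        intro p q hpq
        obtain ⟨p', hp'⟩ := htop p q hpq
        refine ⟨p', hp', ?_⟩
        rcases (hp'.2 p hpq).lt_or_eq with h | h
        · exact Or.inr h
        · exact Or.inl (I.injQ q p' p hp'.1 hpq h)
      have hmem : ∀ p q, (p, q) ∈ I.E.filter (fun f => I.TopForWorker f.2 f.1) ↔
          I.TopForWorker q p := by
        intro p q
        simp only [Finset.mem_filter]
        exact ⟨fun h => h.2, fun h => ⟨h.1, h⟩⟩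
      refine ⟨I.E.filter (fun f => I.TopForWorker f.2 f.1),
        ⟨⟨Finset.filter_subset _ _, ?_⟩, ?_⟩, ?_⟩
      · rintro ⟨a, b⟩ he ⟨c, d⟩ hf h
        rw [hmem] at he hf
        rcases h with h | h
        · simp only at h
          subst h
          rw [I.injP a b d he.1 hf.1 (le_antisymm (hc _ _ _ hf he) (hc _ _ _ he hf))]
        · simp only at h
          subst h
          rw [I.injQ b a c he.1 hf.1 (le_antisymm (he.2 _ hf.1) (hf.2 _ he.1))]
      · rintro ⟨a, b⟩ ⟨he, -, h2⟩
        obtain ⟨p', hp'⟩ := htop a b he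
        exact absurd (h2 p' ((hmem _ _).2 hp')) (not_lt.2 (hp'.2 a he))
      · intro μ' h q p hp
        obtain ⟨p', hp', h'⟩ := hge p q (h.1.1 hp)
        exact ⟨p', (hmem _ _).2 hp', h'⟩

theorem aux_qopt_spec (I : MI P Q) : I.IsQOpt I.qopt := by
  have h := aux_exists_qopt _ I rfl
  unfold qopt
  rw [dif_pos h]
  exact h.choose_spec

theorem aux_contr_stable (I : MI P Q) {μ : Finset (P × Q)} (h : I.IsStable μ) {e : P × Q}
    (he : e ∈ μ) : (I.contr e).IsStable (μ.erase e) := by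
  obtain ⟨⟨hs, hm⟩, hb⟩ := h
  refine ⟨⟨?_, ?_⟩, ?_⟩
  · intro f hf
    obtain ⟨hne, hf⟩ := Finset.mem_erase.1 hf
    exact Finset.mem_filter.2 ⟨hs hf, fun h => hne (hm f hf e he (Or.inl h)),
      fun h => hne (hm f hf e he (Or.inr h))⟩
  · intro f hf g hg
    exact hm f (Finset.mem_of_mem_erase hf) g (Finset.mem_of_mem_erase hg)
  · rintro f ⟨hf, h1, h2⟩
    obtain ⟨hf, hf1, hf2⟩ := Finset.mem_filter.1 hf
    refine hb f ⟨hf, ?_, ?_⟩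
    · intro x hx
      refine h1 x (Finset.mem_erase.2 ⟨?_, hx⟩)
      rintro rfl; exact hf1 rfl
    · intro x hx
      refine h2 x (Finset.mem_erase.2 ⟨?_, hx⟩)
      rintro rfl; exact hf2 rfl

theorem aux_main : ∀ (n : ℕ) (I : MI P Q) (σ : List (P × Q)), σ.length ≤ n →
    (∀ e, e ∈ σ ↔ e ∈ I.E) → ∀ q : Q, I.WGe (I.sfda σ) I.qopt q := by
  intro n
  induction n with
  | zero =>
    intro I σ hn hσ q p hp
    have := (hσ _).2 (qopt_subset I hp)
    rw [List.length_eq_zero_iff.1 (Nat.le_zero.1 hn)] at this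
    simp at this
  | succ n ih =>
    intro I σ hn hσ q p hp
    rw [sfda]
    split
    · next h =>
      have := List.find?_eq_none.1 h _ ((hσ _).2 (qopt_subset I hp))
      simp [hp] at this
    · next e h =>
      have heσ : e ∈ σ := List.mem_of_find?_eq_some h
      have heq : e ∈ I.qopt := by simpa using List.find?_some h
      by_cases hpe : (p, q) = e
      · exact ⟨p, by simp [hpe], Or.inl rfl⟩
      · have hlen : (contrO σ e).length < σ.length :=
          List.length_filter_lt_length_iff_exists.mpr ⟨e, heσ, by simp⟩
        have h1 := ih (I.contr e) (contrO σ e) (by omega) (by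
          intro f
          simp only [contrO, contr, List.mem_filter, Finset.mem_filter, hσ,
            decide_eq_true_eq]) q
        have h2 := (aux_qopt_spec (I.contr e)).2 _
          (aux_contr_stable I (aux_qopt_spec I).1 heq) q
        obtain ⟨p', hmem, hh⟩ := aux_wge_trans _ h1 h2 p (Finset.mem_erase.2 ⟨hpe, hp⟩)
        exact ⟨p', Finset.mem_insert_of_mem hmem, hh⟩

/-- `sfda(I, σ) ⪰_Q qopt(I)` for every offering order `σ`. -/
theorem stmt_5 (P Q : Type) [DecidableEq P] [DecidableEq Q] (I : MI P Q)
    (σ : List (P × Q)) (hσ : I.IsOfferOrder σ)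
    (μ₀ : Finset (P × Q)) (h₀ : I.IsQOpt μ₀) :
    ∀ q : Q, I.WGe (I.sfda σ) μ₀ q := by
  intro q
  exact aux_wge_trans I (aux_main _ I σ le_rfl hσ.2.1 q) ((aux_qopt_spec I).2 _ h₀.1 q)

end MI

end SeqMatching
end

section
/- If I is a (2,∞)-instance, i.e., every firm has at most two acceptable workers, then sfda(I,σ)=qopt(I) for every offering order σ on I. -/
namespace SeqMatching

namespace MI

variable {P Q : Type}

variable [DecidableEq P] [DecidableEq Q]

/-- A matching weakly better for all workers than a stable matching matches the same firms. -/
theorem firm_matched (J : MI P Q) {l m : Finset (P × Q)} (hl : J.IsMatching l)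
    (hm : J.IsStable m) (hge : ∀ q, J.WGe l m q) {p : P} {a : Q} (h : (p, a) ∈ m) :
    ∃ b, (p, b) ∈ l := by
  have inj1 : ∀ k : Finset (P × Q), J.IsMatching k → (k.image Prod.fst).card = k.card := by
    intro k hk
    exact Finset.card_image_of_injOn (fun x hx y hy hxy => hk.2 x hx y hy (Or.inl hxy))
  have inj2 : ∀ k : Finset (P × Q), J.IsMatching k → (k.image Prod.snd).card = k.card := by
    intro k hk
    exact Finset.card_image_of_injOn (fun x hx y hy hxy => hk.2 x hx y hy (Or.inr hxy))
  have s2 : m.image Prod.snd ⊆ l.image Prod.snd := by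
    intro q hq
    obtain ⟨⟨p', q'⟩, h1, rfl⟩ := Finset.mem_image.1 hq
    obtain ⟨p2, h2, -⟩ := hge q' p' h1
    exact Finset.mem_image.2 ⟨(p2, q'), h2, rfl⟩
  have s1 : l.image Prod.fst ⊆ m.image Prod.fst := by
    intro p1 hp1
    obtain ⟨⟨p', q'⟩, h1, rfl⟩ := Finset.mem_image.1 hp1
    by_contra hno
    have hno' : ∀ x, (p', x) ∉ m := fun x hx => hno (Finset.mem_image.2 ⟨(p', x), hx, rfl⟩)
    refine hm.2 (p', q') ⟨hl.1 h1, fun x hx => absurd hx (hno' x), ?_⟩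
    intro p2 hp2
    obtain ⟨p3, h3, h4⟩ := hge q' p2 hp2
    have h5 := hl.2 _ h3 _ h1 (Or.inr rfl)
    have h6 : p3 = p' := congrArg Prod.fst h5
    subst h6
    rcases h4 with rfl | h4
    · exact absurd hp2 (hno' _)
    · exact h4
  have heq := Finset.eq_of_subset_of_card_le s1 (by
    rw [inj1 m hm.1, inj1 l hl, ← inj2 m hm.1, ← inj2 l hl]
    exact Finset.card_le_card s2)
  have : p ∈ l.image Prod.fst := by
    rw [heq]; exact Finset.mem_image.2 ⟨_, h, rfl⟩
  obtain ⟨⟨p', b⟩, hb, rfl⟩ := Finset.mem_image.1 this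
  exact ⟨b, hb⟩

/-- every worker takes the best of the partners in two matchings. -/
def wjoin (J : MI P Q) (m n : Finset (P × Q)) : Finset (P × Q) :=
  (m ∪ n).filter (fun f => ∀ g ∈ m ∪ n, g.2 = f.2 → J.rankQ f.2 f.1 ≤ J.rankQ f.2 g.1)

theorem mem_wjoin (J : MI P Q) (m n : Finset (P × Q)) (p : P) (q : Q) :
    (p, q) ∈ J.wjoin m n ↔ ((p, q) ∈ m ∨ (p, q) ∈ n) ∧
      ∀ p', ((p', q) ∈ m ∨ (p', q) ∈ n) → J.rankQ q p ≤ J.rankQ q p' := by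
  simp only [wjoin, Finset.mem_filter, Finset.mem_union, Prod.forall]
  constructor
  · rintro ⟨h1, h2⟩
    exact ⟨h1, fun p' h => h2 p' q h rfl⟩
  · rintro ⟨h1, h2⟩
    refine ⟨h1, ?_⟩
    rintro p' q' h rfl
    exact h2 p' h

theorem wjoin_ge (J : MI P Q) {m n : Finset (P × Q)} (hm : m ⊆ J.E) (hn : n ⊆ J.E) (p : P) (q : Q)
    (h : (p, q) ∈ m ∨ (p, q) ∈ n) : J.WAtLeast (J.wjoin m n) q p := by
  have hne : ((m ∪ n).filter (fun f => f.2 = q)).Nonempty :=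
    ⟨(p, q), by simpa using h⟩
  obtain ⟨⟨p', q'⟩, h1, h2⟩ := Finset.exists_min_image _ (fun f => J.rankQ q f.1) hne
  simp only [Finset.mem_filter, Finset.mem_union, Prod.forall] at h1 h2
  obtain ⟨h1, rfl⟩ := h1
  refine ⟨p', (J.mem_wjoin m n p' q').2 ⟨h1, fun p2 hp2 => h2 p2 q' ⟨hp2, rfl⟩⟩, ?_⟩
  have h3 := h2 p q' ⟨h, rfl⟩
  rcases h3.eq_or_lt with h3 | h3
  · left
    refine J.injQ q' p' p ?_ ?_ h3
    · exact h1.elim (fun x => hm x) (fun x => hn x)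
    · exact h.elim (fun x => hm x) (fun x => hn x)
  · exact Or.inr h3

/-- a firm cannot get two different workers in the join. -/
theorem wjoin_aux (J : MI P Q) {m n : Finset (P × Q)} (hm : J.IsStable m) (hn : J.IsStable n)
    {p : P} {a b : Q} (ha : (p, a) ∈ m) (hb : (p, b) ∈ n)
    (ha' : ∀ p', ((p', a) ∈ m ∨ (p', a) ∈ n) → J.rankQ a p ≤ J.rankQ a p')
    (hlt : J.rankP p a < J.rankP p b) : False := by
  refine hn.2 (p, a) ⟨hm.1.1 ha, ?_, ?_⟩
  · intro x hx
    have : x = b := congrArg Prod.snd (hn.1.2 _ hx _ hb (Or.inl rfl))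
    subst this
    exact hlt
  · intro p' hp'
    rcases (ha' p' (Or.inr hp')).eq_or_lt with h | h
    · have : p = p' := J.injQ a _ _ (hm.1.1 ha) (hn.1.1 hp') h
      subst this
      have : a = b := congrArg Prod.snd (hn.1.2 _ hp' _ hb (Or.inl rfl))
      subst this
      exact absurd hlt (lt_irrefl _)
    · exact h

theorem wjoin_aux2 (J : MI P Q) {m n : Finset (P × Q)} (hm : J.IsStable m) (hn : J.IsStable n)
    {p : P} {a b : Q} (ha : (p, a) ∈ m) (hb : (p, b) ∈ n)
    (ha' : ∀ p', ((p', a) ∈ m ∨ (p', a) ∈ n) → J.rankQ a p ≤ J.rankQ a p')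
    (hb' : ∀ p', ((p', b) ∈ m ∨ (p', b) ∈ n) → J.rankQ b p ≤ J.rankQ b p') : a = b := by
  rcases lt_trichotomy (J.rankP p a) (J.rankP p b) with h | h | h
  · exact (J.wjoin_aux hm hn ha hb ha' h).elim
  · exact J.injP p a b (hm.1.1 ha) (hn.1.1 hb) h
  · exact (J.wjoin_aux hn hm hb ha (fun p' hp' => hb' p' hp'.symm) h).elim

theorem wjoin_matching (J : MI P Q) {m n : Finset (P × Q)} (hm : J.IsStable m)
    (hn : J.IsStable n) : J.IsMatching (J.wjoin m n) := by
  have sub : J.wjoin m n ⊆ J.E := by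
    rintro ⟨p, q⟩ h
    exact ((J.mem_wjoin m n p q).1 h).1.elim (fun x => hm.1.1 x) (fun x => hn.1.1 x)
  refine ⟨sub, ?_⟩
  rintro ⟨p, q⟩ he ⟨p', q'⟩ hf h
  have he0 := sub he
  have hf0 := sub hf
  obtain ⟨h1, h2⟩ := (J.mem_wjoin m n p q).1 he
  obtain ⟨h3, h4⟩ := (J.mem_wjoin m n p' q').1 hf
  rcases h with h | h
  · dsimp only at h
    subst h
    rcases h1 with h1 | h1 <;> rcases h3 with h3 | h3
    · exact hm.1.2 _ h1 _ h3 (Or.inl rfl)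
    · rw [J.wjoin_aux2 hm hn h1 h3 h2 h4]
    · rw [J.wjoin_aux2 hm hn h3 h1 h4 h2]
    · exact hn.1.2 _ h1 _ h3 (Or.inl rfl)
  · dsimp only at h
    subst h
    rw [J.injQ q p p' he0 hf0 (le_antisymm (h2 _ h3) (h4 _ h1))]

theorem wjoin_stable (J : MI P Q) {m n : Finset (P × Q)} (hm : J.IsStable m)
    (hn : J.IsStable n) : J.IsStable (J.wjoin m n) := by
  have hM := J.wjoin_matching hm hn
  refine ⟨hM, ?_⟩
  rintro ⟨p, q⟩ ⟨hE, hF, hW⟩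
  dsimp only at hF hW
  have hW' : ∀ p', ((p', q) ∈ m ∨ (p', q) ∈ n) → J.rankQ q p < J.rankQ q p' := by
    intro p' hp'
    obtain ⟨p2, h2, h3⟩ := J.wjoin_ge hm.1.1 hn.1.1 p' q hp'
    have := hW p2 h2
    rcases h3 with rfl | h3
    · exact this
    · exact this.trans h3
  have key : ∀ k : Finset (P × Q), J.IsStable k →
      (∀ p', (p', q) ∈ k → J.rankQ q p < J.rankQ q p') →
      ∃ a, (p, a) ∈ k ∧ J.rankP p a ≤ J.rankP p q := by
    intro k hk hkW
    by_contra hcon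
    push Not at hcon
    exact hk.2 (p, q) ⟨hE, fun a ha => hcon a ha, hkW⟩
  obtain ⟨a, ha, ha2⟩ := key m hm (fun p' h => hW' p' (Or.inl h))
  obtain ⟨b, hb, hb2⟩ := key n hn (fun p' h => hW' p' (Or.inr h))
  obtain ⟨c, hc⟩ := J.firm_matched hM hm
    (fun q' p' h => J.wjoin_ge hm.1.1 hn.1.1 p' q' (Or.inl h)) ha
  have hlt := hF c hc
  rcases ((J.mem_wjoin m n p c).1 hc).1 with h | h
  · have : c = a := congrArg Prod.snd (hm.1.2 _ h _ ha (Or.inl rfl))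
    subst this
    omega
  · have : c = b := congrArg Prod.snd (hn.1.2 _ h _ hb (Or.inl rfl))
    subst this
    omega

theorem mem_contr (I : MI P Q) (e : P × Q) (p : P) (q : Q) :
    (p, q) ∈ (I.contr e).E ↔ (p, q) ∈ I.E ∧ p ≠ e.1 ∧ q ≠ e.2 := by
  simp [contr]

/-- contracting a pair of a stable matching keeps the rest stable. -/
theorem erase_stable (I : MI P Q) {m : Finset (P × Q)} (hm : I.IsStable m) {e : P × Q}
    (he : e ∈ m) : (I.contr e).IsStable (m.erase e) := by
  refine ⟨⟨?_, ?_⟩, ?_⟩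
  · rintro ⟨p, q⟩ h
    obtain ⟨h1, h2⟩ := Finset.mem_erase.1 h
    refine (I.mem_contr e p q).2 ⟨hm.1.1 h2, ?_, ?_⟩
    · intro h3; exact h1 (hm.1.2 _ h2 _ he (Or.inl h3))
    · intro h3; exact h1 (hm.1.2 _ h2 _ he (Or.inr h3))
  · intro x hx y hy
    exact hm.1.2 x (Finset.mem_of_mem_erase hx) y (Finset.mem_of_mem_erase hy)
  · rintro ⟨p, q⟩ ⟨hE, hF, hW⟩
    obtain ⟨h1, h2, h3⟩ := (I.mem_contr e p q).1 hE
    refine hm.2 (p, q) ⟨h1, ?_, ?_⟩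
    · intro x hx
      exact hF x (Finset.mem_erase.2 ⟨fun h => h2 (congrArg Prod.fst h), hx⟩)
    · intro x hx
      exact hW x (Finset.mem_erase.2 ⟨fun h => h3 (congrArg Prod.snd h), hx⟩)

theorem insert_stable (I : MI P Q) (h2 : I.FirmsDegTwo) {m l : Finset (P × Q)}
    (hm : I.IsStable m) {e : P × Q} (he : e ∈ m) (hl : (I.contr e).IsStable l)
    (hge : ∀ q, (I.contr e).WGe l (m.erase e) q) : I.IsStable (insert e l) := by
  obtain ⟨p0, q0⟩ := e
  have hlm : ∀ p q, (p, q) ∈ l → (p, q) ∈ I.E ∧ p ≠ p0 ∧ q ≠ q0 := fun p q h =>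
    (I.mem_contr (p0, q0) p q).1 (hl.1.1 h)
  refine ⟨⟨?_, ?_⟩, ?_⟩
  · rintro ⟨p, q⟩ h
    rcases Finset.mem_insert.1 h with h | h
    · rw [h]; exact hm.1.1 he
    · exact (hlm p q h).1
  · rintro ⟨p, q⟩ hx ⟨p', q'⟩ hy h
    rcases Finset.mem_insert.1 hx with hx | hx <;> rcases Finset.mem_insert.1 hy with hy | hy
    · rw [hx, hy]
    · have := hlm _ _ hy
      simp only [Prod.mk.injEq] at hx h
      grind
    · have := hlm _ _ hx
      simp only [Prod.mk.injEq] at hy h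
      grind
    · exact hl.1.2 _ hx _ hy h
  · rintro ⟨p, q⟩ ⟨hE, hF, hW⟩
    dsimp only at hF hW
    by_cases hp : p = p0
    · subst hp
      have hlt := hF q0 (Finset.mem_insert_self _ _)
      have hq : q ≠ q0 := by rintro rfl; exact lt_irrefl _ hlt
      refine hm.2 (p, q) ⟨hE, ?_, ?_⟩
      · intro x hx
        have : x = q0 := congrArg Prod.snd (hm.1.2 _ hx _ he (Or.inl rfl))
        rw [this]; exact hlt
      · intro p' hp'
        obtain ⟨p2, h3, h4⟩ := hge q p' (Finset.mem_erase.2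
          ⟨fun h => hq (congrArg Prod.snd h), hp'⟩)
        have h5 := hW p2 (Finset.mem_insert_of_mem h3)
        rcases h4 with rfl | h4
        · exact h5
        · exact h5.trans h4
    · by_cases hq : q = q0
      · subst hq
        have hlt := hW p0 (Finset.mem_insert_self _ _)
        have hmp : ∃ a, (p, a) ∈ m ∧ I.rankP p a ≤ I.rankP p q := by
          by_contra hcon
          push Not at hcon
          refine hm.2 (p, q) ⟨hE, fun a ha => hcon a ha, ?_⟩
          intro x hx
          have : x = p0 := congrArg Prod.fst (hm.1.2 _ hx _ he (Or.inr rfl))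
          rw [this]; exact hlt
        obtain ⟨a, ha, har⟩ := hmp
        have hane : a ≠ q := by
          rintro rfl
          exact hp (congrArg Prod.fst (hm.1.2 _ ha _ he (Or.inr rfl)))
        obtain ⟨b, hb⟩ := (I.contr (p0, q)).firm_matched hl.1 (I.erase_stable hm he) hge
          (Finset.mem_erase.2 ⟨fun h => hp (congrArg Prod.fst h), ha⟩)
        have hb1 := hlm _ _ hb
        have hb2 := hF b (Finset.mem_insert_of_mem hb)
        have hab : a ≠ b := by rintro rfl; omega
        have h3 : 2 < (I.E.filter (fun f => f.1 = p)).card := by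
          refine Finset.two_lt_card.2 ⟨(p, a), ?_, (p, b), ?_, (p, q), ?_, ?_, ?_, ?_⟩
          · simpa using hm.1.1 ha
          · simpa using hb1.1
          · simpa using hE
          · simpa using hab
          · simpa using hane
          · simpa using hb1.2.2
        have := h2 p
        omega
      · refine hl.2 (p, q) ⟨(I.mem_contr _ p q).2 ⟨hE, hp, hq⟩, ?_, ?_⟩
        · intro x hx; exact hF x (Finset.mem_insert_of_mem hx)
        · intro x hx; exact hW x (Finset.mem_insert_of_mem hx)

theorem contr_qopt (I : MI P Q) (h2 : I.FirmsDegTwo) {m : Finset (P × Q)} (hm : I.IsQOpt m)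
    {e : P × Q} (he : e ∈ m) : (I.contr e).IsQOpt (m.erase e) := by
  have hs := I.erase_stable hm.1 he
  refine ⟨hs, ?_⟩
  intro n hn q p hp
  have hJ := (I.contr e).wjoin_stable hs hn
  have hins := I.insert_stable h2 hm.1 he hJ
    (fun q' p' h => (I.contr e).wjoin_ge hs.1.1 hn.1.1 p' q' (Or.inl h))
  obtain ⟨p1, h1, h1'⟩ := (I.contr e).wjoin_ge hs.1.1 hn.1.1 p q (Or.inr hp)
  obtain ⟨p3, h3, h3'⟩ := hm.2 _ hins q p1 (Finset.mem_insert_of_mem h1)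
  have hq := ((I.mem_contr e p q).1 (hn.1.1 hp)).2.2
  refine ⟨p3, Finset.mem_erase.2 ⟨fun h => hq (congrArg Prod.snd h), h3⟩, ?_⟩
  change p1 = p ∨ I.rankQ q p1 < I.rankQ q p at h1'
  change p3 = p ∨ I.rankQ q p3 < I.rankQ q p
  rcases h1' with rfl | h1'
  · exact h3'
  · rcases h3' with rfl | h3'
    · exact Or.inr h1'
    · exact Or.inr (h3'.trans h1')

theorem qopt_sub (I : MI P Q) {m n : Finset (P × Q)} (hm : I.IsQOpt m) (hn : I.IsQOpt n) :
    m ⊆ n := by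
  rintro ⟨p, q⟩ h
  obtain ⟨p1, h1, h1'⟩ := hn.2 _ hm.1 q p h
  obtain ⟨p3, h3, h3'⟩ := hm.2 _ hn.1 q p1 h1
  have : p3 = p := congrArg Prod.fst (hm.1.1.2 _ h3 _ h (Or.inr rfl))
  subst this
  rcases h1' with rfl | h1'
  · exact h1
  · rcases h3' with rfl | h3'
    · exact h1
    · omega

theorem qopt_eq (I : MI P Q) {m : Finset (P × Q)} (hm : I.IsQOpt m) : I.qopt = m := by
  have hex : ∃ μ, I.IsQOpt μ := ⟨m, hm⟩
  have : I.IsQOpt I.qopt := by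
    unfold qopt
    rw [dif_pos hex]
    exact hex.choose_spec
  exact Finset.Subset.antisymm (I.qopt_sub this hm) (I.qopt_sub hm this)

theorem contr_degTwo (I : MI P Q) (h2 : I.FirmsDegTwo) (e : P × Q) :
    (I.contr e).FirmsDegTwo := by
  intro p
  refine le_trans (Finset.card_le_card ?_) (h2 p)
  exact Finset.filter_subset_filter _ (Finset.filter_subset _ _)

theorem sfda_eq (k : ℕ) : ∀ (I : MI P Q) (σ : List (P × Q)) (m : Finset (P × Q)),
    σ.length = k → I.FirmsDegTwo → (∀ e ∈ I.E, e ∈ σ) → I.IsQOpt m → I.sfda σ = m := by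
  induction k using Nat.strong_induction_on with
  | _ k ih =>
    intro I σ m hk h2 hσ hm
    have hq := I.qopt_eq hm
    unfold sfda
    split
    · next h =>
      rw [List.find?_eq_none] at h
      symm
      apply Finset.eq_empty_of_forall_notMem
      intro x hx
      exact h x (hσ x (hm.1.1.1 hx)) (by simpa [hq] using hx)
    · next e h =>
      have he : e ∈ σ := List.mem_of_find?_eq_some h
      have hem : e ∈ m := by
        have := List.find?_some h
        simpa [hq] using this
      have hlen : (contrO σ e).length < k := by
        rw [← hk]
        exact List.length_filter_lt_length_iff_exists.mpr ⟨e, he, by simp⟩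
      rw [ih _ hlen (I.contr e) (contrO σ e) (m.erase e) rfl (I.contr_degTwo h2 e) ?_
        (I.contr_qopt h2 hm hem)]
      · exact Finset.insert_erase hem
      · rintro ⟨p, q⟩ hf
        have h3 := (I.mem_contr e p q).1 hf
        exact List.mem_filter.2 ⟨hσ _ h3.1, by simpa using h3.2⟩

/-- if every firm has at most two acceptable workers, then
`sfda(I, σ) = qopt(I)` for every offering order `σ`. -/
theorem stmt_8 (P Q : Type) [DecidableEq P] [DecidableEq Q] (I : MI P Q)
    (h2 : I.FirmsDegTwo)
    (σ : List (P × Q)) (hσ : I.IsOfferOrder σ)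
    (μ₀ : Finset (P × Q)) (h₀ : I.IsQOpt μ₀) :
    I.sfda σ = μ₀ := by
  exact sfda_eq _ I σ μ₀ rfl h2 (fun e he => (hσ.2.1 e).2 he) h₀

end MI

end SeqMatching
end
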